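/- Let q ≥ 2 be an integer and let 0 < b < a be real numbers. If f : ℂ^q → ℂ is holomorphic on the spherical shell A = {w ∈ ℂ^q : b < ‖w‖ < a} (i.e. complex-differentiable at every point of A), then there exists a function F : ℂ^q → ℂ that is holomorphic on the open ball B = {w ∈ ℂ^q : ‖w‖ < a} and satisfies F(w) = f(w) for all w ∈ A. -/

import Mathlib

open Metric Set Filter Topology

/-- The Fréchet derivative of a holomorphic function on an open subset of a complex normed space
is continuous. -/
theorem DifferentiableOn.continuousOn_fderiv_of_isOpen_complex
    {E F : Type*} [NormedAddCommGroup E] [NormedSpace ℂ E] [NormedAddCommGroup F]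
    [NormedSpace ℂ F] {f : E → F} {U : Set E} (hU : IsOpen U) (hf : DifferentiableOn ℂ f U) :
    ContinuousOn (fderiv ℂ f) U := by
  intro x hx
  obtain ⟨δ, hδ, hball⟩ : ∃ δ > 0, ball x δ ⊆ U ∩ f ⁻¹' ball (f x) 1 :=
    Metric.mem_nhds_iff.1 (inter_mem (hU.mem_nhds hx)
      ((hf.differentiableAt (hU.mem_nhds hx)).continuousAt (ball_mem_nhds _ one_pos)))
  have hdiff : ∀ y ∈ ball x δ, DifferentiableAt ℂ f y := fun y hy =>
    hf.differentiableAt (hU.mem_nhds (hball hy).1)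
  set ρ := δ / 3 with hρ
  have hρ0 : 0 < ρ := by positivity
  have hderiv : ∀ y ∈ ball x (2 * ρ), ‖fderiv ℂ f y‖ ≤ 2 / ρ := by
    intro y hy
    have hsub : ball y ρ ⊆ ball x δ := ball_subset_ball' (by
      rw [mem_ball] at hy
      linarith)
    refine Complex.norm_fderiv_le_div_of_mapsTo_ball
      (fun z hz => (hdiff z (hsub hz)).differentiableWithinAt) (fun z hz => ?_) hρ0
    have h₁ := mem_ball.1 (hball (hsub hz)).2
    have h₂ := mem_ball.1 (hball (hsub (mem_ball_self hρ0))).2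
    rw [mem_closedBall]
    linarith [dist_triangle_right (f z) (f y) (f x)]
  have hlip : ∀ y ∈ ball x (2 * ρ), ∀ z ∈ ball x (2 * ρ), ‖f z - f y‖ ≤ 2 / ρ * ‖z - y‖ := by
    intro y hy z hz
    have : NormedSpace ℝ E := NormedSpace.restrictScalars ℝ ℂ E
    exact (convex_ball x (2 * ρ)).norm_image_sub_le_of_norm_fderiv_le
      (fun w hw => hdiff w (ball_subset_ball (by linarith) hw)) hderiv hy hz
  refine ContinuousAt.continuousWithinAt ?_
  rw [ContinuousAt, tendsto_iff_norm_sub_tendsto_zero]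
  have hlim : Tendsto (fun y => 2 * (2 / ρ * ‖y - x‖) / ρ) (𝓝 x) (𝓝 0) := by
    have : Continuous fun y => 2 * (2 / ρ * ‖y - x‖) / ρ := by fun_prop
    simpa using this.tendsto x
  refine squeeze_zero' (Eventually.of_forall fun _ => norm_nonneg _) ?_ hlim
  filter_upwards [ball_mem_nhds x hρ0] with y hy
  have hshift : ∀ z ∈ ball x ρ, z + (y - x) ∈ ball x (2 * ρ) := by
    intro z hz
    rw [mem_ball_iff_norm] at hz hy ⊢
    calc ‖z + (y - x) - x‖ = ‖(z - x) + (y - x)‖ := by congr 1; abel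
      _ ≤ ‖z - x‖ + ‖y - x‖ := norm_add_le _ _
      _ < 2 * ρ := by linarith
  have hd : ∀ z ∈ ball x ρ, HasFDerivAt (fun z => f (z + (y - x)) - f z)
      (fderiv ℂ f (z + (y - x)) - fderiv ℂ f z) z := by
    intro z hz
    have h₁ := (hdiff _ (ball_subset_ball (by linarith) (hshift z hz))).hasFDerivAt
    have h₂ := (hdiff _ (ball_subset_ball (by linarith) hz)).hasFDerivAt
    exact ((hasFDerivAt_comp_add_right (y - x)).2 h₁).sub h₂
  have hbound : ∀ z ∈ ball x ρ, ‖f (z + (y - x)) - f z‖ ≤ 2 / ρ * ‖y - x‖ := by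
    intro z hz
    simpa using hlip z (ball_subset_ball (by linarith) hz) _ (hshift z hz)
  have := Complex.norm_fderiv_le_div_of_mapsTo_ball (R₂ := 2 * (2 / ρ * ‖y - x‖))
    (fun z hz => (hd z hz).differentiableAt.differentiableWithinAt) (fun z hz => ?_) hρ0
  · simpa [(hd x (mem_ball_self hρ0)).fderiv] using this
  · rw [mem_closedBall, dist_eq_norm]
    linarith [norm_sub_le (f (z + (y - x)) - f z) (f (x + (y - x)) - f x), hbound z hz,
      hbound x (mem_ball_self hρ0)]

/-- A circle integral depends holomorphically on a parameter if its integrand is jointly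
holomorphic near the circle. -/
theorem differentiableAt_circleIntegral_of_differentiableOn
    {E : Type*} [NormedAddCommGroup E] [NormedSpace ℂ E] {H : E × ℂ → ℂ} {U : Set (E × ℂ)}
    (hU : IsOpen U) (hH : DifferentiableOn ℂ H U) {x₀ : E} {r : ℝ} (hr : 0 ≤ r)
    (hsub : ∀ ζ ∈ sphere (0 : ℂ) r, (x₀, ζ) ∈ U) :
    DifferentiableAt ℂ (fun x => ∮ ζ in C(0, r), H (x, ζ)) x₀ := by
  have hcont := hH.continuousOn_fderiv_of_isOpen_complex hU
  have hK : IsCompact ({x₀} ×ˢ sphere (0 : ℂ) r) := isCompact_singleton.prod (isCompact_sphere 0 r)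
  have hKU : {x₀} ×ˢ sphere (0 : ℂ) r ⊆ U := by
    rintro ⟨x, ζ⟩ ⟨rfl, hζ⟩
    exact hsub ζ hζ
  obtain ⟨C, hC⟩ := hK.exists_bound_of_continuousOn (hcont.mono hKU)
  have hW : IsOpen (U ∩ (fun p => ‖fderiv ℂ H p‖) ⁻¹' Iio (C + 1)) :=
    hcont.norm.isOpen_inter_preimage hU isOpen_Iio
  obtain ⟨V, S, hV, -, hxV, hS, hVS⟩ := generalized_tube_lemma (isCompact_singleton (x := x₀))
    (isCompact_sphere (0 : ℂ) r) hW
    (fun p hp => ⟨hKU hp, (hC p hp).trans_lt (lt_add_one C)⟩)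
  have hmem : ∀ x ∈ V, ∀ θ : ℝ, (x, circleMap 0 r θ) ∈
      U ∩ (fun p => ‖fderiv ℂ H p‖) ⁻¹' Iio (C + 1) := fun x hx θ =>
    hVS ⟨hx, hS (circleMap_mem_sphere 0 hr θ)⟩
  have hVx : V ∈ 𝓝 x₀ := hV.mem_nhds (hxV rfl)
  have hpair : ∀ x : E, Continuous fun θ : ℝ => (x, circleMap 0 r θ) := fun x => by fun_prop
  have hvel : Continuous fun θ : ℝ => deriv (circleMap 0 r) θ := by
    simp only [deriv_circleMap]
    fun_prop
  have hF : ∀ x ∈ V, Continuous fun θ : ℝ => deriv (circleMap 0 r) θ • H (x, circleMap 0 r θ) :=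
    fun x hx => hvel.smul (hH.continuousOn.comp_continuous (hpair x) fun θ => (hmem x hx θ).1)
  have hF' : Continuous fun θ : ℝ => deriv (circleMap 0 r) θ •
      (fderiv ℂ H (x₀, circleMap 0 r θ)).comp (ContinuousLinearMap.inl ℂ E ℂ) :=
    hvel.smul ((hcont.comp_continuous (hpair x₀) fun θ => (hmem x₀ (hxV rfl) θ).1).clm_comp
      continuous_const)
  refine (intervalIntegral.hasFDerivAt_integral_of_dominated_of_fderiv_le
    (F := fun x θ => deriv (circleMap 0 r) θ • H (x, circleMap 0 r θ))
    (F' := fun x θ => deriv (circleMap 0 r) θ •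
      (fderiv ℂ H (x, circleMap 0 r θ)).comp (ContinuousLinearMap.inl ℂ E ℂ))
    (bound := fun _ => r * (C + 1)) hVx ?_ ((hF x₀ (hxV rfl)).intervalIntegrable _ _)
    hF'.aestronglyMeasurable ?_ intervalIntegrable_const ?_).differentiableAt
  · filter_upwards [hVx] with x hx using (hF x hx).aestronglyMeasurable
  · refine Eventually.of_forall fun θ _ x hx => ?_
    have h₁ : ‖(fderiv ℂ H (x, circleMap 0 r θ)).comp (ContinuousLinearMap.inl ℂ E ℂ)‖
        ≤ C + 1 := by
      refine (ContinuousLinearMap.opNorm_comp_le _ _).trans ?_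
      have h₂ : ‖fderiv ℂ H (x, circleMap 0 r θ)‖ < C + 1 := (hmem x hx θ).2
      have h₃ := ContinuousLinearMap.norm_inl_le_one ℂ E ℂ
      nlinarith [norm_nonneg (fderiv ℂ H (x, circleMap 0 r θ))]
    rw [norm_smul]
    have h₄ : ‖deriv (circleMap 0 r) θ‖ = r := by simp [deriv_circleMap, abs_of_nonneg hr]
    rw [h₄]
    gcongr
  · refine Eventually.of_forall fun θ _ x hx => ?_
    have h₁ := (hH.differentiableAt (hU.mem_nhds (hmem x hx θ).1)).hasFDerivAt
    have h₂ := h₁.comp (f := fun y => (y, circleMap 0 r θ)) x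
      (hasFDerivAt_prodMk_left x (circleMap 0 r θ))
    exact h₂.const_smul (deriv (circleMap 0 r) θ)

/-- **Identity theorem** for holomorphic functions on a preconnected open subset of a complex
normed space. -/
theorem DifferentiableOn.eqOn_zero_of_isPreconnected_of_eventuallyEq_zero
    {E : Type*} [NormedAddCommGroup E] [NormedSpace ℂ E] {h : E → ℂ} {U : Set E}
    (hU : IsOpen U) (hconn : IsPreconnected U) (hh : DifferentiableOn ℂ h U) {x₀ : E}
    (hx₀ : x₀ ∈ U) (hzero : h =ᶠ[𝓝 x₀] 0) : EqOn h 0 U := by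
  suffices U ⊆ {x | h =ᶠ[𝓝 x] 0} from fun x hx => (this hx).eq_of_nhds
  refine hconn.subset_of_closure_inter_subset isOpen_setOfPred_eventually_nhds ⟨x₀, hx₀, hzero⟩ ?_
  rintro x ⟨hxc, hxU⟩
  obtain ⟨δ, hδ, hball⟩ := Metric.isOpen_iff.1 hU x hxU
  obtain ⟨y, hy, hyx⟩ := Metric.mem_closure_iff.1 hxc δ hδ
  filter_upwards [ball_mem_nhds x hδ] with z hz
  let _ : NormedSpace ℝ E := NormedSpace.restrictScalars ℝ ℂ E
  let L : ℂ → E := fun t => y + t • (z - y)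
  have hL : Differentiable ℂ L := by fun_prop
  have hLV : IsOpen (L ⁻¹' ball x δ) := isOpen_ball.preimage hL.continuous
  have hLc : Convex ℝ (L ⁻¹' ball x δ) := by
    intro s hs t ht α β hα hβ hαβ
    have hαβ' : (β : ℂ) = 1 - α := by
      rw [eq_sub_iff_add_eq']
      exact_mod_cast hαβ
    have hcomb : L (α • s + β • t) = α • L s + β • L t := by
      change y + ((α : ℂ) * s + (β : ℂ) * t) • (z - y) =
        (α : ℂ) • (y + s • (z - y)) + (β : ℂ) • (y + t • (z - y))
      rw [hαβ']
      module
    rw [mem_preimage, hcomb]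
    exact convex_ball x δ hs ht hα hβ hαβ
  have hana : AnalyticOnNhd ℂ (h ∘ L) (L ⁻¹' ball x δ) :=
    ((hh.mono hball).comp hL.differentiableOn (mapsTo_preimage _ _)).analyticOnNhd hLV
  have hL0 : L 0 = y := by simp [L]
  have hev : h ∘ L =ᶠ[𝓝 0] 0 := by
    have : Tendsto L (𝓝 0) (𝓝 y) := hL0 ▸ hL.continuous.tendsto 0
    exact this.eventually hy
  have := hana.eqOn_zero_of_preconnected_of_eventuallyEq_zero hLc.isPreconnected
    (by rw [mem_preimage, hL0]; rwa [mem_ball, dist_comm]) hev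
    (show (1 : ℂ) ∈ _ by simpa [L] using hz)
  simpa [L] using this

/-- Open spherical shells are preconnected in real dimension at least two. -/
theorem isPreconnected_shell {E : Type*} [NormedAddCommGroup E] [NormedSpace ℝ E]
    (hE : 1 < Module.rank ℝ E) {a b : ℝ} (hb : 0 ≤ b) :
    IsPreconnected {w : E | b < ‖w‖ ∧ ‖w‖ < a} := by
  have himage : {w : E | b < ‖w‖ ∧ ‖w‖ < a} =
      (fun p : ℝ × E => p.1 • p.2) '' (Ioo b a ×ˢ sphere (0 : E) 1) := by
    ext w
    constructor
    · rintro ⟨h₁, h₂⟩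
      have hw : ‖w‖ ≠ 0 := (hb.trans_lt h₁).ne'
      exact ⟨(‖w‖, ‖w‖⁻¹ • w), ⟨⟨h₁, h₂⟩, by simp [norm_smul, hw]⟩, by simp [smul_smul, hw]⟩
    · rintro ⟨⟨t, x⟩, ⟨⟨h₁, h₂⟩, hx⟩, rfl⟩
      rw [mem_sphere_zero_iff_norm] at hx
      have ht : 0 < t := hb.trans_lt h₁
      simp only at h₁ h₂ hx
      simp [norm_smul, hx, abs_of_pos ht, h₁, h₂]
  rw [himage]
  exact (isPreconnected_Ioo.prod (isPreconnected_sphere hE 0 1)).image _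
    (by fun_prop)

section Slices

variable {q : ℕ} [NeZero q]

/-- The point `w` with its zeroth coordinate replaced by `ζ`. -/
noncomputable def replaceZeroth (w : EuclideanSpace ℂ (Fin q)) (ζ : ℂ) : EuclideanSpace ℂ (Fin q) :=
  w + (ζ - w 0) • EuclideanSpace.single 0 1

theorem replaceZeroth_self (w : EuclideanSpace ℂ (Fin q)) : replaceZeroth w (w 0) = w := by
  simp [replaceZeroth]

theorem norm_sq_replaceZeroth (w : EuclideanSpace ℂ (Fin q)) (ζ : ℂ) :
    ‖replaceZeroth w ζ‖ ^ 2 = ‖w‖ ^ 2 - ‖w 0‖ ^ 2 + ‖ζ‖ ^ 2 := by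
  rw [EuclideanSpace.norm_sq_eq, EuclideanSpace.norm_sq_eq,
    ← Finset.add_sum_erase _ _ (Finset.mem_univ (0 : Fin q)),
    ← Finset.add_sum_erase _ (fun i => ‖w i‖ ^ 2) (Finset.mem_univ (0 : Fin q))]
  have hrest : ∑ i ∈ Finset.univ.erase (0 : Fin q), ‖replaceZeroth w ζ i‖ ^ 2 =
      ∑ i ∈ Finset.univ.erase (0 : Fin q), ‖w i‖ ^ 2 :=
    Finset.sum_congr rfl fun i hi => by simp [replaceZeroth, Finset.ne_of_mem_erase hi]
  have hzero : replaceZeroth w ζ 0 = ζ := by simp [replaceZeroth]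
  rw [hrest, hzero]
  ring

theorem differentiable_replaceZeroth :
    Differentiable ℂ fun p : EuclideanSpace ℂ (Fin q) × ℂ => replaceZeroth p.1 p.2 := by
  unfold replaceZeroth
  fun_prop

/-- The Cauchy integral of `f` in the zeroth coordinate, over the circle of radius `r`. -/
noncomputable def sliceCauchyIntegral (f : EuclideanSpace ℂ (Fin q) → ℂ) (r : ℝ)
    (w : EuclideanSpace ℂ (Fin q)) : ℂ :=
  (2 * Real.pi * Complex.I : ℂ)⁻¹ • ∮ ζ in C(0, r), (ζ - w 0)⁻¹ • f (replaceZeroth w ζ)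

variable {a b : ℝ} {f : EuclideanSpace ℂ (Fin q) → ℂ}

theorem differentiableAt_slice (ha : 0 ≤ a)
    (hf : ∀ w : EuclideanSpace ℂ (Fin q), b < ‖w‖ → ‖w‖ < a → DifferentiableAt ℂ f w)
    {w : EuclideanSpace ℂ (Fin q)} {ζ : ℂ} (h₁ : b ^ 2 < ‖w‖ ^ 2 - ‖w 0‖ ^ 2 + ‖ζ‖ ^ 2)
    (h₂ : ‖w‖ ^ 2 - ‖w 0‖ ^ 2 + ‖ζ‖ ^ 2 < a ^ 2) :
    DifferentiableAt ℂ f (replaceZeroth w ζ) := by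
  rw [← norm_sq_replaceZeroth] at h₁ h₂
  exact hf _ (lt_of_pow_lt_pow_left₀ 2 (norm_nonneg _) h₁) (lt_of_pow_lt_pow_left₀ 2 ha h₂)

theorem differentiableAt_sliceCauchyIntegral (ha : 0 ≤ a)
    (hf : ∀ w : EuclideanSpace ℂ (Fin q), b < ‖w‖ → ‖w‖ < a → DifferentiableAt ℂ f w)
    {w : EuclideanSpace ℂ (Fin q)} {r : ℝ} (hr : ‖w 0‖ < r)
    (h₁ : b ^ 2 < ‖w‖ ^ 2 - ‖w 0‖ ^ 2 + r ^ 2) (h₂ : ‖w‖ ^ 2 - ‖w 0‖ ^ 2 + r ^ 2 < a ^ 2) :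
    DifferentiableAt ℂ (sliceCauchyIntegral f r) w := by
  let N : EuclideanSpace ℂ (Fin q) × ℂ → ℝ := fun p => ‖p.1‖ ^ 2 - ‖p.1 0‖ ^ 2 + ‖p.2‖ ^ 2
  have hN : Continuous N := by fun_prop
  have hcoord : Continuous fun p : EuclideanSpace ℂ (Fin q) × ℂ => ‖p.1 0‖ := by fun_prop
  have hU : IsOpen {p : EuclideanSpace ℂ (Fin q) × ℂ |
      ‖p.1 0‖ < ‖p.2‖ ∧ b ^ 2 < N p ∧ N p < a ^ 2} :=
    (isOpen_lt hcoord continuous_snd.norm).inter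
      ((isOpen_lt continuous_const hN).inter (isOpen_lt hN continuous_const))
  refine (differentiableAt_circleIntegral_of_differentiableOn
    (H := fun p : EuclideanSpace ℂ (Fin q) × ℂ => (p.2 - p.1 0)⁻¹ • f (replaceZeroth p.1 p.2)) hU ?_
    ((norm_nonneg _).trans hr.le) ?_).const_smul (2 * Real.pi * Complex.I : ℂ)⁻¹
  · rintro ⟨x, ζ⟩ ⟨hx, hx₁, hx₂⟩
    have hne : ζ - x 0 ≠ 0 := by
      rw [sub_ne_zero]
      rintro rfl
      exact lt_irrefl _ hx
    have hslice := (differentiableAt_slice ha hf hx₁ hx₂).comp (x, ζ)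
      (f := fun p : EuclideanSpace ℂ (Fin q) × ℂ => replaceZeroth p.1 p.2)
      (differentiable_replaceZeroth (x, ζ))
    have hker : DifferentiableAt ℂ
        (fun p : EuclideanSpace ℂ (Fin q) × ℂ => (p.2 - p.1 0)⁻¹) (x, ζ) :=
      DifferentiableAt.inv (by fun_prop) hne
    exact (hker.smul hslice).differentiableWithinAt
  · intro ζ hζ
    rw [mem_sphere_zero_iff_norm] at hζ
    simpa [N, hζ] using ⟨hr, h₁, h₂⟩

theorem sliceCauchyIntegral_eq_of_le (ha : 0 ≤ a)
    (hf : ∀ w : EuclideanSpace ℂ (Fin q), b < ‖w‖ → ‖w‖ < a → DifferentiableAt ℂ f w)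
    {w : EuclideanSpace ℂ (Fin q)} {r R : ℝ} (hr : ‖w 0‖ < r) (hrR : r ≤ R)
    (h₁ : b ^ 2 < ‖w‖ ^ 2 - ‖w 0‖ ^ 2 + r ^ 2) (h₂ : ‖w‖ ^ 2 - ‖w 0‖ ^ 2 + R ^ 2 < a ^ 2) :
    sliceCauchyIntegral f R w = sliceCauchyIntegral f r w := by
  have hr0 : 0 < r := (norm_nonneg _).trans_lt hr
  have hd : ∀ ζ : ℂ, r ≤ ‖ζ‖ → ‖ζ‖ ≤ R →
      DifferentiableAt ℂ (fun ζ => (ζ - w 0)⁻¹ • f (replaceZeroth w ζ)) ζ := by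
    intro ζ h₃ h₄
    have hne : ζ - w 0 ≠ 0 := by
      rw [sub_ne_zero]
      rintro rfl
      linarith
    have hslice := (differentiableAt_slice ha hf (w := w) (ζ := ζ) (by nlinarith)
      (by nlinarith)).comp ζ (f := replaceZeroth w) (by unfold replaceZeroth; fun_prop)
    have hker : DifferentiableAt ℂ (fun ζ => (ζ - w 0)⁻¹) ζ :=
      DifferentiableAt.inv (by fun_prop) hne
    exact hker.smul hslice
  unfold sliceCauchyIntegral
  rw [Complex.circleIntegral_eq_of_differentiable_on_annulus_off_countable hr0 hrR countable_empty]
  · rintro ζ ⟨h₃, h₄⟩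
    exact (hd ζ (by simpa using h₄) (by simpa using h₃)).continuousAt.continuousWithinAt
  · rintro ζ ⟨⟨h₃, h₄⟩, -⟩
    rw [mem_ball_zero_iff] at h₃
    rw [mem_closedBall_zero_iff, not_le] at h₄
    exact hd ζ h₄.le h₃.le

theorem sliceCauchyIntegral_eq_self (ha : 0 ≤ a)
    (hf : ∀ w : EuclideanSpace ℂ (Fin q), b < ‖w‖ → ‖w‖ < a → DifferentiableAt ℂ f w)
    {w : EuclideanSpace ℂ (Fin q)} {r : ℝ} (hr : ‖w 0‖ < r)
    (h₁ : b ^ 2 < ‖w‖ ^ 2 - ‖w 0‖ ^ 2) (h₂ : ‖w‖ ^ 2 - ‖w 0‖ ^ 2 + r ^ 2 < a ^ 2) :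
    sliceCauchyIntegral f r w = f w := by
  have hd : DifferentiableOn ℂ (fun ζ => f (replaceZeroth w ζ)) (closedBall 0 r) := by
    intro ζ hζ
    rw [mem_closedBall_zero_iff] at hζ
    refine ((differentiableAt_slice ha hf (w := w) (ζ := ζ) (by nlinarith [norm_nonneg ζ])
      (by nlinarith [norm_nonneg ζ])).comp ζ (f := replaceZeroth w)
      (by unfold replaceZeroth; fun_prop)).differentiableWithinAt
  rw [sliceCauchyIntegral, hd.circleIntegral_sub_inv_smul (mem_ball_zero_iff.2 hr),
    inv_smul_smul₀ Complex.two_pi_I_ne_zero, replaceZeroth_self]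

end Slices

/-- Hartogs extension across the inner ball: for `q ≥ 2`, a function
holomorphic on the spherical shell `{b < ‖w‖ < a}` in `ℂ^q` extends to a function
holomorphic on the whole ball `{‖w‖ < a}`. -/
theorem statement2 (q : ℕ) (hq : 2 ≤ q) (a b : ℝ) (hb : 0 < b) (hba : b < a)
    (f : EuclideanSpace ℂ (Fin q) → ℂ)
    (hf : ∀ w : EuclideanSpace ℂ (Fin q), b < ‖w‖ → ‖w‖ < a → DifferentiableAt ℂ f w) :
    ∃ F : EuclideanSpace ℂ (Fin q) → ℂ,
      (∀ w : EuclideanSpace ℂ (Fin q), ‖w‖ < a → DifferentiableAt ℂ F w) ∧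
      (∀ w : EuclideanSpace ℂ (Fin q), b < ‖w‖ → ‖w‖ < a → F w = f w) := by
  have : NeZero q := ⟨by omega⟩
  have ha : 0 < a := hb.trans hba
  let radius : EuclideanSpace ℂ (Fin q) → ℝ := fun w =>
    √((max (b ^ 2) (‖w‖ ^ 2) + a ^ 2) / 2 - (‖w‖ ^ 2 - ‖w 0‖ ^ 2))
  have hradius : ∀ w : EuclideanSpace ℂ (Fin q), ‖w‖ < a → ‖w 0‖ < radius w ∧
      b ^ 2 < ‖w‖ ^ 2 - ‖w 0‖ ^ 2 + radius w ^ 2 ∧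
      ‖w‖ ^ 2 - ‖w 0‖ ^ 2 + radius w ^ 2 < a ^ 2 := by
    intro w hw
    have hwa : ‖w‖ ^ 2 < a ^ 2 := pow_lt_pow_left₀ hw (norm_nonneg _) two_ne_zero
    have hba' : b ^ 2 < a ^ 2 := pow_lt_pow_left₀ hba hb.le two_ne_zero
    have hmax := max_lt hba' hwa
    have hle₁ := le_max_left (b ^ 2) (‖w‖ ^ 2)
    have hle₂ := le_max_right (b ^ 2) (‖w‖ ^ 2)
    have hsq : radius w ^ 2 =
        (max (b ^ 2) (‖w‖ ^ 2) + a ^ 2) / 2 - (‖w‖ ^ 2 - ‖w 0‖ ^ 2) :=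
      Real.sq_sqrt (by nlinarith [sq_nonneg ‖w 0‖])
    exact ⟨Real.lt_sqrt_of_sq_lt (by linarith), by linarith, by linarith⟩
  let F : EuclideanSpace ℂ (Fin q) → ℂ := fun w => sliceCauchyIntegral f (radius w) w
  have hF : ∀ w : EuclideanSpace ℂ (Fin q), ‖w‖ < a → DifferentiableAt ℂ F w := by
    intro w hw
    obtain ⟨h₁, h₂, h₃⟩ := hradius w hw
    refine (differentiableAt_sliceCauchyIntegral ha.le hf h₁ h₂ h₃).congr_of_eventuallyEq ?_
    have hcont : Continuous fun x : EuclideanSpace ℂ (Fin q) =>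
        ‖x‖ ^ 2 - ‖x 0‖ ^ 2 + radius w ^ 2 := by fun_prop
    have hcoord : Continuous fun x : EuclideanSpace ℂ (Fin q) => ‖x 0‖ := by fun_prop
    filter_upwards [continuous_norm.tendsto w |>.eventually_lt_const hw,
      hcoord.tendsto w |>.eventually_lt_const h₁, hcont.tendsto w |>.eventually_const_lt h₂,
      hcont.tendsto w |>.eventually_lt_const h₃] with x hx hx₁ hx₂ hx₃
    obtain ⟨h₄, h₅, h₆⟩ := hradius x hx
    rcases le_total (radius w) (radius x) with hle | hle
    · exact sliceCauchyIntegral_eq_of_le ha.le hf hx₁ hle hx₂ h₆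
    · exact (sliceCauchyIntegral_eq_of_le ha.le hf h₄ hle h₅ hx₃).symm
  refine ⟨F, hF, fun w hw₁ hw₂ => ?_⟩
  let i : Fin q := ⟨1, hq⟩
  have hi : (0 : Fin q) ≠ i := by simp [i, Fin.ext_iff]
  let x₀ : EuclideanSpace ℂ (Fin q) := EuclideanSpace.single i (((a + b) / 2 : ℝ) : ℂ)
  have hx₀ : ‖x₀‖ = (a + b) / 2 := by
    rw [PiLp.norm_single, Complex.norm_real, Real.norm_of_nonneg (by linarith)]
  have hx₀' : x₀ 0 = 0 := by simp [x₀, hi]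
  have hrank : 1 < Module.rank ℝ (EuclideanSpace ℂ (Fin q)) := by
    have hfin : Module.finrank ℝ (EuclideanSpace ℂ (Fin q)) = 2 * q := by
      rw [← Module.finrank_mul_finrank ℝ ℂ]
      simp
    rw [← Module.finrank_eq_rank, hfin]
    exact_mod_cast (by omega : 1 < 2 * q)
  have hopen : IsOpen {w : EuclideanSpace ℂ (Fin q) | b < ‖w‖ ∧ ‖w‖ < a} :=
    (isOpen_lt continuous_const continuous_norm).inter (isOpen_lt continuous_norm continuous_const)
  refine sub_eq_zero.1 (DifferentiableOn.eqOn_zero_of_isPreconnected_of_eventuallyEq_zero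
    (h := fun w => F w - f w) (x₀ := x₀) hopen (isPreconnected_shell hrank hb.le)
    (fun x hx => ((hF x hx.2).sub (hf x hx.1 hx.2)).differentiableWithinAt)
    ⟨by linarith, by linarith⟩ ?_ ⟨hw₁, hw₂⟩)
  have hcont : Continuous fun x : EuclideanSpace ℂ (Fin q) => ‖x‖ ^ 2 - ‖x 0‖ ^ 2 := by fun_prop
  filter_upwards [continuous_norm.tendsto x₀ |>.eventually_lt_const (show ‖x₀‖ < a by linarith),
    hcont.tendsto x₀ |>.eventually_const_lt (show b ^ 2 < ‖x₀‖ ^ 2 - ‖x₀ 0‖ ^ 2 by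
      rw [hx₀, hx₀']
      simp only [norm_zero]
      nlinarith)] with x hx hxb
  obtain ⟨h₁, -, h₃⟩ := hradius x hx
  exact sub_eq_zero.2 (sliceCauchyIntegral_eq_self ha.le hf h₁ hxb h₃)
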